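/- The face of Ptt(n) defined by the flow equations Σ_{j ∈ V∖{i}} y_{t,i,j} = 1 for all i,t ∈ V with i ≠ t, and Σ_{i ∈ V∖{j}} y_{t,i,j} = 1 for all j,t ∈ V with j ≠ t, is equal to conv{(χ(T),ψ(T)) ∈ {0,1}^M × {0,1}^{V×A} : T a tournament}; that is, {(x,y) ∈ Ptt(n) : (x,y) satisfies all these equations} = conv{(χ(T),ψ(T)) : T a tournament}. -/

import Mathlib

open Finset

attribute [local instance] Classical.propDecidable

namespace TTP

/-- `(k,i,j)` is a valid match index: slot `k ∈ S = {1,…,2n-2}`, home venue `i` and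
away team `j` are distinct elements of `V = {1,…,n}`. -/
def IsMatch (n : ℕ) (m : ℕ × ℕ × ℕ) : Prop :=
  1 ≤ m.1 ∧ m.1 ≤ 2 * n - 2 ∧ 1 ≤ m.2.1 ∧ m.2.1 ≤ n ∧ 1 ≤ m.2.2 ∧ m.2.2 ≤ n ∧ m.2.1 ≠ m.2.2

/-- `(t,i,j)` is a valid travel index: `t ∈ V` and `(i,j) ∈ A`. -/
def IsTravelIdx (n : ℕ) (p : ℕ × ℕ × ℕ) : Prop :=
  1 ≤ p.1 ∧ p.1 ≤ n ∧ 1 ≤ p.2.1 ∧ p.2.1 ≤ n ∧ 1 ≤ p.2.2 ∧ p.2.2 ≤ n ∧ p.2.1 ≠ p.2.2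

/-- A (double round-robin) tournament: a set of matches such that in every slot every team
plays exactly once, and every ordered pair of distinct teams meets exactly once. -/
structure IsTournament (n : ℕ) (T : Set (ℕ × ℕ × ℕ)) : Prop where
  subset : ∀ m ∈ T, IsMatch n m
  slot_team : ∀ k, 1 ≤ k → k ≤ 2 * n - 2 → ∀ t, 1 ≤ t → t ≤ n →
      ∃! m : ℕ × ℕ × ℕ, m ∈ T ∧ m.1 = k ∧ (t = m.2.1 ∨ t = m.2.2)
  pair : ∀ i j, 1 ≤ i → i ≤ n → 1 ≤ j → j ≤ n → i ≠ j → ∃! k : ℕ, (k, i, j) ∈ T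

/-- The venue of team `t` in slot `k`: the home venue of the (unique) match of `t` in
slot `k`, and `t` itself if `t` has no match in slot `k` (in particular in the artificial
slots `0` and `2n-1`). -/
noncomputable def venue (T : Set (ℕ × ℕ × ℕ)) (t k : ℕ) : ℕ :=
  if h : ∃ i, ∃ j, (k, i, j) ∈ T ∧ (t = i ∨ t = j) then h.choose else t

/-- The travel vector `ψ(T)`: `travel n T (t,i,j) = 1` iff for some `0 ≤ k ≤ 2n-2` team `t`
has venue `i` in slot `k` and venue `j` in slot `k+1`. -/
noncomputable def travel (n : ℕ) (T : Set (ℕ × ℕ × ℕ)) (p : ℕ × ℕ × ℕ) : ℝ :=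
  if ∃ k, k ≤ 2 * n - 2 ∧ venue T p.1 k = p.2.1 ∧ venue T p.1 (k + 1) = p.2.2 then 1 else 0

/-- The play vector `χ(T)`: characteristic vector of `T`. -/
noncomputable def play (T : Set (ℕ × ℕ × ℕ)) (m : ℕ × ℕ × ℕ) : ℝ :=
  if m ∈ T then 1 else 0

/-- The ambient space `ℝ^M × ℝ^{V×A}`. -/
abbrev Pt (n : ℕ) :=
  ({m : ℕ × ℕ × ℕ // IsMatch n m} → ℝ) × ({p : ℕ × ℕ × ℕ // IsTravelIdx n p} → ℝ)

/-- The play coordinate `x_{k,i,j}` of a point (0 at invalid indices). -/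
noncomputable def xval {n : ℕ} (z : Pt n) (k i j : ℕ) : ℝ :=
  if h : IsMatch n (k, i, j) then z.1 ⟨(k, i, j), h⟩ else 0

/-- The travel coordinate `y_{t,i,j}` of a point (0 at invalid indices). -/
noncomputable def yval {n : ℕ} (z : Pt n) (t i j : ℕ) : ℝ :=
  if h : IsTravelIdx n (t, i, j) then z.2 ⟨(t, i, j), h⟩ else 0

/-- The unconstrained traveling tournament polytope `Ptt(n)`:
the convex hull of all pairs `(χ(T), y)` with `T` a tournament and `y ∈ {0,1}^{V×A}`,
`y ≥ ψ(T)` componentwise. -/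
def Ptt (n : ℕ) : Set (Pt n) :=
  convexHull ℝ { z : Pt n | ∃ T : Set (ℕ × ℕ × ℕ), IsTournament n T ∧
    (∀ m : {m : ℕ × ℕ × ℕ // IsMatch n m}, z.1 m = play T m.1) ∧
    (∀ p : {p : ℕ × ℕ × ℕ // IsTravelIdx n p}, z.2 p = 0 ∨ z.2 p = 1) ∧
    (∀ p : {p : ℕ × ℕ × ℕ // IsTravelIdx n p}, travel n T p.1 ≤ z.2 p) }

/-- Dimension of the affine hull of a set. -/
noncomputable def adim {n : ℕ} (s : Set (Pt n)) : ℕ :=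
  Module.finrank ℝ (affineSpan ℝ s).direction

/-- A valid inequality `f z ≤ γ` is facet-defining for `Ptt(n)`:
it holds on `Ptt(n)` and its face has dimension `dim Ptt(n) - 1`. -/
def IsFacetLE {n : ℕ} (f : Pt n → ℝ) (γ : ℝ) : Prop :=
  (∀ z ∈ Ptt n, f z ≤ γ) ∧ adim {z ∈ Ptt n | f z = γ} + 1 = adim (Ptt n)

/-- A valid inequality `f z ≥ γ` is facet-defining for `Ptt(n)`:
it holds on `Ptt(n)` and its face has dimension `dim Ptt(n) - 1`. -/
def IsFacetGE {n : ℕ} (f : Pt n → ℝ) (γ : ℝ) : Prop :=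
  (∀ z ∈ Ptt n, γ ≤ f z) ∧ adim {z ∈ Ptt n | f z = γ} + 1 = adim (Ptt n)


/-- A face of a convex hull, cut out by a valid linear inequality, is the convex hull of the
generators on it. -/
theorem mem_convexHull_of_eq_min {E : Type*} [AddCommGroup E] [Module ℝ E] {s : Set E}
    (f : E →ₗ[ℝ] ℝ) {c : ℝ} (hf : ∀ x ∈ s, c ≤ f x) {x : E} (hx : x ∈ convexHull ℝ s)
    (hxc : f x = c) : x ∈ convexHull ℝ {y ∈ s | f y = c} := by
  set F := convexHull ℝ {y ∈ s | f y = c} with hF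
  have hFc : ∀ y ∈ F, f y = c := fun y hy =>
    convexHull_min (fun z hz => hz.2) (convex_hyperplane f.isLinear c) hy
  have hge : ∀ y, c < f y ∨ y ∈ F → c ≤ f y := by
    rintro y (h | h)
    · exact h.le
    · exact (hFc y h).ge
  have hconv : Convex ℝ {y | c < f y ∨ y ∈ F} := by
    refine convex_iff_forall_pos.2 fun y hy z hz a b ha hb hab => ?_
    have hy' := hge y hy
    have hz' := hge z hz
    have hc : c = a * c + b * c := by rw [← add_mul, hab, one_mul]
    have hfe : f (a • y + b • z) = a * f y + b * f z := by simp
    rcases hy with hy | hy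
    · left
      rw [hfe]
      nlinarith [mul_lt_mul_of_pos_left hy ha, mul_le_mul_of_nonneg_left hz' hb.le]
    rcases hz with hz | hz
    · left
      rw [hfe]
      nlinarith [mul_lt_mul_of_pos_left hz hb, mul_le_mul_of_nonneg_left hy' ha.le]
    · exact Or.inr (convex_convexHull ℝ _ hy hz ha.le hb.le hab)
  have hsub : s ⊆ {y | c < f y ∨ y ∈ F} := fun y hy =>
    (hf y hy).lt_or_eq.imp id fun h => subset_convexHull ℝ _ ⟨hy, h.symm⟩
  exact (convexHull_min hsub hconv hx).resolve_left hxc.not_gt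

section Venue

variable {n : ℕ} {T : Set (ℕ × ℕ × ℕ)} {t i j k : ℕ}

theorem mem_of_venue_eq (h : venue T t k = i) (hi : i ≠ t) : (k, i, t) ∈ T := by
  unfold venue at h
  split_ifs at h with hex
  · obtain ⟨j, hj, hor⟩ := hex.choose_spec
    rw [h] at hj hor
    rcases hor with rfl | rfl
    · exact absurd rfl hi
    · exact hj
  · exact absurd h.symm hi

theorem IsTournament.venue_eq (hT : IsTournament n T) (h : (k, i, t) ∈ T) :
    venue T t k = i := by
  obtain ⟨hk1, hk2, -, -, ht1, ht2, -⟩ := hT.subset _ h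
  have hex : ∃ i, ∃ j, (k, i, j) ∈ T ∧ (t = i ∨ t = j) := ⟨i, t, h, Or.inr rfl⟩
  unfold venue
  rw [dif_pos hex]
  obtain ⟨j, hj, hor⟩ := hex.choose_spec
  have := (hT.slot_team k hk1 hk2 t ht1 ht2).unique ⟨hj, rfl, hor⟩ ⟨h, rfl, Or.inr rfl⟩
  simp only [Prod.mk.injEq] at this
  exact this.2.1

theorem IsTournament.venue_mem_Icc (hT : IsTournament n T) (ht1 : 1 ≤ t) (ht2 : t ≤ n) :
    1 ≤ venue T t k ∧ venue T t k ≤ n := by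
  by_cases h : venue T t k = t
  · rw [h]
    exact ⟨ht1, ht2⟩
  · obtain ⟨-, -, h1, h2, -⟩ := hT.subset _ (mem_of_venue_eq rfl h)
    exact ⟨h1, h2⟩

theorem IsTournament.slot_eq (hT : IsTournament n T) {k' : ℕ} (h : (k, i, t) ∈ T)
    (h' : (k', i, t) ∈ T) : k = k' := by
  obtain ⟨-, -, h1, h2, h3, h4, h5⟩ := hT.subset _ h
  exact (hT.pair i t h1 h2 h3 h4 h5).unique h h'

theorem IsTournament.sum_travel_from (hT : IsTournament n T) (hi1 : 1 ≤ i) (hi2 : i ≤ n)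
    (ht1 : 1 ≤ t) (ht2 : t ≤ n) (hit : i ≠ t) :
    ∑ j ∈ Finset.Icc 1 n \ {i}, travel n T (t, i, j) = 1 := by
  obtain ⟨k, hk, -⟩ := hT.pair i t hi1 hi2 ht1 ht2 hit
  obtain ⟨hk1, hk2, -⟩ := hT.subset _ hk
  have hv := hT.venue_eq hk
  have hne : venue T t (k + 1) ≠ i := fun h => by
    have := hT.slot_eq hk (mem_of_venue_eq h hit)
    omega
  rw [Finset.sum_eq_single (venue T t (k + 1))]
  · exact if_pos ⟨k, hk2, hv, rfl⟩
  · rintro j - hj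
    refine if_neg ?_
    rintro ⟨k', -, h1, h2⟩
    obtain rfl := hT.slot_eq hk (mem_of_venue_eq h1 hit)
    exact hj h2.symm
  · intro h
    exact absurd (by simpa using ⟨hT.venue_mem_Icc ht1 ht2, hne⟩) h

theorem IsTournament.sum_travel_to (hT : IsTournament n T) (hj1 : 1 ≤ j) (hj2 : j ≤ n)
    (ht1 : 1 ≤ t) (ht2 : t ≤ n) (hjt : j ≠ t) :
    ∑ i ∈ Finset.Icc 1 n \ {j}, travel n T (t, i, j) = 1 := by
  obtain ⟨k, hk, -⟩ := hT.pair j t hj1 hj2 ht1 ht2 hjt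
  obtain ⟨hk1, hk2, -⟩ := hT.subset _ hk
  obtain ⟨l, rfl⟩ : ∃ l, k = l + 1 := ⟨k - 1, by simp at hk1; omega⟩
  have hv := hT.venue_eq hk
  have hne : venue T t l ≠ j := fun h => by
    have := hT.slot_eq hk (mem_of_venue_eq h hjt)
    omega
  rw [Finset.sum_eq_single (venue T t l)]
  · exact if_pos ⟨l, (Nat.le_succ l).trans hk2, rfl, hv⟩
  · rintro i - hi
    refine if_neg ?_
    rintro ⟨k', -, h1, h2⟩
    obtain rfl := Nat.succ_injective (hT.slot_eq hk (mem_of_venue_eq h2 hjt))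
    exact hi h1.symm
  · intro h
    exact absurd (by simpa using ⟨hT.venue_mem_Icc ht1 ht2, hne⟩) h

end Venue

theorem isTravelIdx_of_mem {n t i j : ℕ} (ht : 1 ≤ t ∧ t ≤ n) (hi : 1 ≤ i ∧ i ≤ n)
    (hj : j ∈ Finset.Icc 1 n \ {i}) : IsTravelIdx n (t, i, j) := by
  simp only [Finset.mem_sdiff, Finset.mem_Icc, Finset.mem_singleton] at hj
  exact ⟨ht.1, ht.2, hi.1, hi.2, hj.1.1, hj.1.2, fun h => hj.2 h.symm⟩

theorem isTravelIdx_of_mem' {n t i j : ℕ} (ht : 1 ≤ t ∧ t ≤ n) (hj : 1 ≤ j ∧ j ≤ n)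
    (hi : i ∈ Finset.Icc 1 n \ {j}) : IsTravelIdx n (t, i, j) := by
  simp only [Finset.mem_sdiff, Finset.mem_Icc, Finset.mem_singleton] at hi
  exact ⟨ht.1, ht.2, hi.1.1, hi.1.2, hj.1, hj.2, hi.2⟩

/-- The travel coordinate `y_{t,i,j}` as a linear functional. -/
noncomputable def yvalLinear (n t i j : ℕ) : Pt n →ₗ[ℝ] ℝ where
  toFun z := yval z t i j
  map_add' z w := by unfold yval; split_ifs <;> simp
  map_smul' a z := by unfold yval; split_ifs <;> simp

/-- The total travel of team `t` leaving venue `i`. -/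
noncomputable def outflow (n t i : ℕ) : Pt n →ₗ[ℝ] ℝ :=
  ∑ j ∈ Finset.Icc 1 n \ {i}, yvalLinear n t i j

/-- The total travel of team `t` entering venue `j`. -/
noncomputable def inflow (n t j : ℕ) : Pt n →ₗ[ℝ] ℝ :=
  ∑ i ∈ Finset.Icc 1 n \ {j}, yvalLinear n t i j

theorem outflow_apply {n : ℕ} (z : Pt n) (t i : ℕ) :
    outflow n t i z = ∑ j ∈ Finset.Icc 1 n \ {i}, yval z t i j := by
  simp [outflow, yvalLinear]

theorem inflow_apply {n : ℕ} (z : Pt n) (t j : ℕ) :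
    inflow n t j z = ∑ i ∈ Finset.Icc 1 n \ {j}, yval z t i j := by
  simp [inflow, yvalLinear]

/-- The sum of the left-hand sides of all flow equations. -/
noncomputable def totalFlow (n : ℕ) : Pt n →ₗ[ℝ] ℝ :=
  ∑ t ∈ Finset.Icc 1 n, ∑ i ∈ Finset.Icc 1 n \ {t}, (outflow n t i + inflow n t i)

theorem totalFlow_apply {n : ℕ} (z : Pt n) :
    totalFlow n z =
      ∑ t ∈ Finset.Icc 1 n, ∑ i ∈ Finset.Icc 1 n \ {t}, (outflow n t i z + inflow n t i z) := by
  simp [totalFlow]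

section Flow

variable {n : ℕ} {T : Set (ℕ × ℕ × ℕ)} {z : Pt n} {t i j : ℕ}

theorem travel_le_yval (hz : ∀ p : {p : ℕ × ℕ × ℕ // IsTravelIdx n p}, travel n T p.1 ≤ z.2 p)
    (h : IsTravelIdx n (t, i, j)) : travel n T (t, i, j) ≤ yval z t i j := by
  unfold yval
  rw [dif_pos h]
  exact hz ⟨_, h⟩

theorem IsTournament.one_le_outflow (hT : IsTournament n T)
    (hz : ∀ p : {p : ℕ × ℕ × ℕ // IsTravelIdx n p}, travel n T p.1 ≤ z.2 p)
    (hi : 1 ≤ i ∧ i ≤ n) (ht : 1 ≤ t ∧ t ≤ n) (hit : i ≠ t) : 1 ≤ outflow n t i z := by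
  rw [outflow_apply, ← hT.sum_travel_from hi.1 hi.2 ht.1 ht.2 hit]
  exact Finset.sum_le_sum fun j hj => travel_le_yval hz (isTravelIdx_of_mem ht hi hj)

theorem IsTournament.one_le_inflow (hT : IsTournament n T)
    (hz : ∀ p : {p : ℕ × ℕ × ℕ // IsTravelIdx n p}, travel n T p.1 ≤ z.2 p)
    (hj : 1 ≤ j ∧ j ≤ n) (ht : 1 ≤ t ∧ t ≤ n) (hjt : j ≠ t) : 1 ≤ inflow n t j z := by
  rw [inflow_apply, ← hT.sum_travel_to hj.1 hj.2 ht.1 ht.2 hjt]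
  exact Finset.sum_le_sum fun i hi => travel_le_yval hz (isTravelIdx_of_mem' ht hj hi)

/-- A point above the travel vector of a tournament that satisfies all flow equations has exactly
that travel vector. -/
theorem IsTournament.eq_travel_of_flow (hT : IsTournament n T)
    (hz : ∀ p : {p : ℕ × ℕ × ℕ // IsTravelIdx n p}, travel n T p.1 ≤ z.2 p)
    (hflow : ∀ t ∈ Finset.Icc 1 n, ∀ i ∈ Finset.Icc 1 n \ {t},
      outflow n t i z = 1 ∧ inflow n t i z = 1)
    (p : {p : ℕ × ℕ × ℕ // IsTravelIdx n p}) : z.2 p = travel n T p.1 := by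
  obtain ⟨⟨t, i, j⟩, h⟩ := p
  have hy : z.2 ⟨(t, i, j), h⟩ = yval z t i j := by rw [yval, dif_pos h]
  obtain ⟨ht1, ht2, hi1, hi2, hj1, hj2, hij⟩ := id h
  dsimp only at ht1 ht2 hi1 hi2 hj1 hj2 hij
  rw [hy]
  by_cases hit : i = t
  · have hjt : j ≠ t := fun e => hij (hit.trans e.symm)
    have hs := (hflow t (by simp [ht1, ht2]) j (by simp [*])).2
    rw [inflow_apply, ← hT.sum_travel_to hj1 hj2 ht1 ht2 hjt] at hs
    exact ((Finset.sum_eq_sum_iff_of_le fun i hi => travel_le_yval hz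
      (isTravelIdx_of_mem' ⟨ht1, ht2⟩ ⟨hj1, hj2⟩ hi)).1 hs.symm i (by simp [hi1, hi2, hij])).symm
  · have hs := (hflow t (by simp [ht1, ht2]) i (by simp [*])).1
    rw [outflow_apply, ← hT.sum_travel_from hi1 hi2 ht1 ht2 hit] at hs
    exact ((Finset.sum_eq_sum_iff_of_le fun j hj => travel_le_yval hz
      (isTravelIdx_of_mem ⟨ht1, ht2⟩ ⟨hi1, hi2⟩ hj)).1 hs.symm j
        (by simp [hj1, hj2, hij.symm])).symm

end Flow

/-- the face of `Ptt(n)` defined by the flow equations is the convex hull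
of all pairs `(χ(T), ψ(T))` with `T` a tournament. -/
theorem flow_equations_face (n : ℕ) (hn : 4 ≤ n) (heven : Even n) :
    { z : Pt n | z ∈ Ptt n ∧
      (∀ i t, 1 ≤ i → i ≤ n → 1 ≤ t → t ≤ n → i ≠ t →
        ∑ j ∈ Finset.Icc 1 n \ {i}, yval z t i j = 1) ∧
      (∀ j t, 1 ≤ j → j ≤ n → 1 ≤ t → t ≤ n → j ≠ t →
        ∑ i ∈ Finset.Icc 1 n \ {j}, yval z t i j = 1) } =
    convexHull ℝ { z : Pt n | ∃ T : Set (ℕ × ℕ × ℕ), IsTournament n T ∧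
      (∀ m : {m : ℕ × ℕ × ℕ // IsMatch n m}, z.1 m = play T m.1) ∧
      (∀ p : {p : ℕ × ℕ × ℕ // IsTravelIdx n p}, z.2 p = travel n T p.1) } := by
  simp only [← outflow_apply, ← inflow_apply]
  have bounds : ∀ {t i : ℕ}, t ∈ Finset.Icc 1 n → i ∈ Finset.Icc 1 n \ {t} →
      (1 ≤ t ∧ t ≤ n) ∧ (1 ≤ i ∧ i ≤ n) ∧ i ≠ t := by
    intro t i ht hi
    simp only [Finset.mem_sdiff, Finset.mem_Icc, Finset.mem_singleton] at ht hi
    exact ⟨ht, hi⟩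
  apply Set.Subset.antisymm
  · rintro z ⟨hz, hout, hin⟩
    have hle : ∀ {T : Set (ℕ × ℕ × ℕ)} {w : Pt n}, IsTournament n T →
        (∀ p : {p : ℕ × ℕ × ℕ // IsTravelIdx n p}, travel n T p.1 ≤ w.2 p) →
        ∀ t ∈ Finset.Icc 1 n, ∀ i ∈ Finset.Icc 1 n \ {t},
          1 ≤ outflow n t i w ∧ 1 ≤ inflow n t i w := by
      intro T w hT hw t ht i hi
      obtain ⟨ht, hi, hit⟩ := bounds ht hi
      exact ⟨hT.one_le_outflow hw hi ht hit, hT.one_le_inflow hw hi ht hit⟩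
    have hadd : ∀ {T : Set (ℕ × ℕ × ℕ)} {w : Pt n}, IsTournament n T →
        (∀ p : {p : ℕ × ℕ × ℕ // IsTravelIdx n p}, travel n T p.1 ≤ w.2 p) →
        ∀ t ∈ Finset.Icc 1 n, ∀ i ∈ Finset.Icc 1 n \ {t},
          (1 + 1 : ℝ) ≤ outflow n t i w + inflow n t i w := fun hT hw t ht i hi =>
      add_le_add (hle hT hw t ht i hi).1 (hle hT hw t ht i hi).2
    have hmem := mem_convexHull_of_eq_min (totalFlow n)
      (c := ∑ t ∈ Finset.Icc 1 n, ∑ i ∈ Finset.Icc 1 n \ {t}, (1 + 1 : ℝ)) ?_ hz ?_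
    · refine convexHull_mono ?_ hmem
      rintro w ⟨⟨T, hT, hplay, -, hw⟩, hc⟩
      refine ⟨T, hT, hplay, hT.eq_travel_of_flow hw fun t ht i hi => ?_⟩
      rw [totalFlow_apply] at hc
      have h1 := (Finset.sum_eq_sum_iff_of_le fun t ht =>
        Finset.sum_le_sum (hadd hT hw t ht)).1 hc.symm t ht
      have h2 := (Finset.sum_eq_sum_iff_of_le (hadd hT hw t ht)).1 h1 i hi
      obtain ⟨h3, h4⟩ := hle hT hw t ht i hi
      constructor <;> linarith
    · rintro w ⟨T, hT, -, -, hw⟩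
      rw [totalFlow_apply]
      exact Finset.sum_le_sum fun t ht => Finset.sum_le_sum (hadd hT hw t ht)
    · rw [totalFlow_apply]
      refine Finset.sum_congr rfl fun t ht => Finset.sum_congr rfl fun i hi => ?_
      obtain ⟨ht, hi, hit⟩ := bounds ht hi
      rw [hout i t hi.1 hi.2 ht.1 ht.2 hit, hin i t hi.1 hi.2 ht.1 ht.2 hit]
  · intro z hz
    refine ⟨convexHull_mono ?_ hz, fun i t hi1 hi2 ht1 ht2 hit => ?_,
      fun j t hj1 hj2 ht1 ht2 hjt => ?_⟩
    · rintro w ⟨T, hT, hplay, hw⟩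
      refine ⟨T, hT, hplay, fun p => ?_, fun p => (hw p).ge⟩
      rw [hw p]
      unfold travel
      split_ifs <;> simp
    · refine convexHull_min ?_ (convex_hyperplane (outflow n t i).isLinear 1) hz
      rintro w ⟨T, hT, -, hw⟩
      rw [Set.mem_ofPred_eq, outflow_apply, ← hT.sum_travel_from hi1 hi2 ht1 ht2 hit]
      refine Finset.sum_congr rfl fun j hj => ?_
      have hidx := isTravelIdx_of_mem ⟨ht1, ht2⟩ ⟨hi1, hi2⟩ hj
      exact (dif_pos hidx).trans (hw ⟨_, hidx⟩)
    · refine convexHull_min ?_ (convex_hyperplane (inflow n t j).isLinear 1) hz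
      rintro w ⟨T, hT, -, hw⟩
      rw [Set.mem_ofPred_eq, inflow_apply, ← hT.sum_travel_to hj1 hj2 ht1 ht2 hjt]
      refine Finset.sum_congr rfl fun i hi => ?_
      have hidx := isTravelIdx_of_mem' ⟨ht1, ht2⟩ ⟨hj1, hj2⟩ hi
      exact (dif_pos hidx).trans (hw ⟨_, hidx⟩)

end TTP
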